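/- arXiv:2112.08049 — 8 statements merged into one kernel-verified Lean document; each statement's English description precedes it below -/
import Mathlib

section
/- Explicit similarity solution for η(w) = κ(w) = w: for every B > 0, the pair (V(y), W(y)) = (y/√2, B² − y²/4) satisfies, for all y with |y| < 2B, the similarity ODE system −(y/2) V'(y) = (W(y) V'(y))' and −(y/2) W'(y) = (W(y) W'(y))' + W(y) (V'(y))², and W(y) ≥ 0 on this interval with W(±2B) = 0 and V(±2B) = ±√2 B. -/
theorem hasDerivAt_sub_sq_div_four (c y : ℝ) :
    HasDerivAt (fun z : ℝ => c - z ^ 2 / 4) (-(y / 2)) y := by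
  refine (((hasDerivAt_pow 2 y).div_const 4).const_sub c).congr_deriv ?_
  norm_num
  ring

/-- Explicit similarity solution for `η(w) = κ(w) = w`: for every `B > 0`,
the pair `(V(y), W(y)) = (y/√2, B² − y²/4)` satisfies, for `|y| < 2B`, the similarity ODE
system `−(y/2)V' = (W V')'`, `−(y/2)W' = (W W')' + W (V')²`, with `W ≥ 0` on this interval,
`W(±2B) = 0` and `V(±2B) = ±√2 B`. -/
theorem explicit_similarity_solution (B : ℝ) (hB : 0 < B) :
    (∀ y : ℝ, |y| < 2 * B →
      (-(y / 2) * deriv (fun z : ℝ => z / Real.sqrt 2) y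
          = deriv (fun z : ℝ => (B ^ 2 - z ^ 2 / 4) * deriv (fun z' : ℝ => z' / Real.sqrt 2) z) y ∧
       -(y / 2) * deriv (fun z : ℝ => B ^ 2 - z ^ 2 / 4) y
          = deriv (fun z : ℝ => (B ^ 2 - z ^ 2 / 4) * deriv (fun z' : ℝ => B ^ 2 - z' ^ 2 / 4) z) y
            + (B ^ 2 - y ^ 2 / 4) * (deriv (fun z : ℝ => z / Real.sqrt 2) y) ^ 2 ∧
       0 ≤ B ^ 2 - y ^ 2 / 4)) ∧
    B ^ 2 - (2 * B) ^ 2 / 4 = 0 ∧ B ^ 2 - (-(2 * B)) ^ 2 / 4 = 0 ∧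
    (2 * B) / Real.sqrt 2 = Real.sqrt 2 * B ∧
    (-(2 * B)) / Real.sqrt 2 = -(Real.sqrt 2 * B) := by
  have hV (y : ℝ) : deriv (fun z : ℝ => z / Real.sqrt 2) y = 1 / Real.sqrt 2 :=
    ((hasDerivAt_id' y).div_const _).deriv
  have hW (y : ℝ) : deriv (fun z : ℝ => B ^ 2 - z ^ 2 / 4) y = -(y / 2) :=
    (hasDerivAt_sub_sq_div_four _ y).deriv
  have hs : Real.sqrt 2 ^ 2 = 2 := Real.sq_sqrt (by norm_num)
  have hs0 : Real.sqrt 2 ≠ 0 := by positivity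
  simp only [hV, hW]
  refine ⟨fun y hy => ⟨?_, ?_, ?_⟩, by ring, by ring, ?_, ?_⟩
  · exact ((hasDerivAt_sub_sq_div_four _ y).mul_const _).deriv.symm
  · rw [((hasDerivAt_sub_sq_div_four (B ^ 2) y).fun_mul
      ((hasDerivAt_id' y).div_const 2).fun_neg).deriv, div_pow, hs]
    ring
  · have := sq_lt_sq' (abs_lt.mp hy).1 (abs_lt.mp hy).2
    linarith
  · field_simp
    linear_combination -hs
  · field_simp
    linear_combination hs
end

section
/- One-dimensional steady-state classification: let η, κ : [0,∞) → [0,∞) be continuously differentiable with η(s) > 0 and κ(s) > 0 for all s > 0, and let v, w : ℝ → ℝ be C² with w(x) ≥ 0 for all x, satisfying the steady system (η(w) v')' = 0 and (κ(w) w')' + η(w)(v')² = 0 on ℝ. Then w is constant on ℝ, and η(w(x))·(v'(x))² = 0 for all x; in particular, if w ≡ w_* > 0 then v is constant. -/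
open Set

/-- A function on `ℝ` that is bounded below by `0` and has an antitone derivative has zero
derivative. -/
theorem eq_zero_of_hasDerivAt_of_antitone_of_nonneg {P F : ℝ → ℝ}
    (hP : ∀ x, HasDerivAt P (F x) x) (hF : Antitone F) (hnn : ∀ x, 0 ≤ P x) (a : ℝ) :
    F a = 0 := by
  have tangent : ∀ x, P x ≤ P a + F a * (x - a) := by
    intro x
    have hcont : Continuous P := continuous_iff_continuousAt.2 fun y => (hP y).continuousAt
    rcases lt_trichotomy x a with h | h | h
    · obtain ⟨c, hc, hslope⟩ :=
        exists_hasDerivAt_eq_slope P F h hcont.continuousOn fun y _ => hP y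
      rw [eq_div_iff (by linarith)] at hslope
      nlinarith [hF hc.2.le]
    · simp [h]
    · obtain ⟨c, hc, hslope⟩ :=
        exists_hasDerivAt_eq_slope P F h hcont.continuousOn fun y _ => hP y
      rw [eq_div_iff (by linarith)] at hslope
      nlinarith [hF hc.1.le]
  by_contra hne
  have h := tangent (a - (P a + 1) / F a)
  have hval : F a * (a - (P a + 1) / F a - a) = -(P a + 1) := by field_simp; ring
  linarith [hnn (a - (P a + 1) / F a)]

/-- The pressure `∫₀^w κ` is a nonnegative primitive of the flux `κ(w) w'`. -/
theorem exists_nonneg_primitive_of_flux {κ w : ℝ → ℝ} (hκ : ContinuousOn κ (Ici 0))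
    (hκnn : ∀ s, 0 ≤ s → 0 ≤ κ s) (hw : Differentiable ℝ w) (hwnn : ∀ x, 0 ≤ w x) :
    ∃ P : ℝ → ℝ, (∀ x, 0 ≤ P x) ∧ ∀ x, HasDerivAt P (κ (w x) * deriv w x) x := by
  have hcont : Continuous fun s => κ (max s 0) :=
    hκ.comp_continuous (by fun_prop) fun s => le_max_right s 0
  refine ⟨fun x => ∫ s in (0 : ℝ)..w x, κ (max s 0), fun x => ?_, fun x => ?_⟩
  · exact intervalIntegral.integral_nonneg (hwnn x) fun s _ => hκnn _ (le_max_right s 0)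
  · have h := (hcont.integral_hasStrictDerivAt 0 (w x)).hasDerivAt.comp x (hw x).hasDerivAt
    rw [max_eq_left (hwnn x)] at h
    exact h

/-- One-dimensional steady-state classification: for C¹ coefficients
`η, κ : [0,∞) → [0,∞)` positive on `(0,∞)` and C² functions `v, w : ℝ → ℝ` with `w ≥ 0`
solving the steady system `(η(w)v')' = 0`, `(κ(w)w')' + η(w)(v')² = 0` on `ℝ`, the
function `w` is constant, `η(w)(v')² ≡ 0`, and if `w > 0` everywhere then `v` is constant. -/
theorem steady_state_classification_1d
    (η κ : ℝ → ℝ)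
    (hη : ContDiffOn ℝ 1 η (Ici 0)) (hκ : ContDiffOn ℝ 1 κ (Ici 0))
    (hηnn : ∀ s : ℝ, 0 ≤ s → 0 ≤ η s) (hκnn : ∀ s : ℝ, 0 ≤ s → 0 ≤ κ s)
    (hηpos : ∀ s : ℝ, 0 < s → 0 < η s) (hκpos : ∀ s : ℝ, 0 < s → 0 < κ s)
    (v w : ℝ → ℝ) (hv : ContDiff ℝ 2 v) (hw : ContDiff ℝ 2 w)
    (hwnn : ∀ x : ℝ, 0 ≤ w x)
    (heq1 : ∀ x : ℝ, deriv (fun y => η (w y) * deriv v y) x = 0)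
    (heq2 : ∀ x : ℝ, deriv (fun y => κ (w y) * deriv w y) x + η (w x) * (deriv v x) ^ 2 = 0) :
    (∀ x y : ℝ, w x = w y) ∧
    (∀ x : ℝ, η (w x) * (deriv v x) ^ 2 = 0) ∧
    ((∀ x : ℝ, 0 < w x) → ∀ x y : ℝ, v x = v y) := by
  have hwd : Differentiable ℝ w := hw.differentiable (by norm_num)
  have hflux : Differentiable ℝ fun y => κ (w y) * deriv w y :=
    ((hκ.comp_contDiff (hw.of_le (by norm_num)) hwnn).differentiable (by norm_num)).mul
      hw.differentiable_deriv_two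
  have hanti : Antitone fun y => κ (w y) * deriv w y :=
    antitone_of_deriv_nonpos hflux fun x => by
      linarith [heq2 x, mul_nonneg (hηnn _ (hwnn x)) (sq_nonneg (deriv v x))]
  obtain ⟨P, hPnn, hP⟩ := exists_nonneg_primitive_of_flux hκ.continuousOn hκnn hwd hwnn
  have hzero : ∀ x, κ (w x) * deriv w x = 0 :=
    eq_zero_of_hasDerivAt_of_antitone_of_nonneg hP hanti hPnn
  have hw' : ∀ x, deriv w x = 0 := by
    intro x
    rcases (hwnn x).eq_or_lt with h | h
    · exact IsLocalMin.deriv_eq_zero (Filter.Eventually.of_forall fun y => h ▸ hwnn y)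
    · exact (mul_eq_zero.1 (hzero x)).resolve_left (hκpos _ h).ne'
  have hdiss : ∀ x, η (w x) * (deriv v x) ^ 2 = 0 := by
    intro x
    simpa [hzero] using heq2 x
  refine ⟨is_const_of_deriv_eq_zero hwd hw', hdiss, fun hpos => ?_⟩
  refine is_const_of_deriv_eq_zero (hv.differentiable (by norm_num)) fun x => ?_
  exact pow_eq_zero_iff two_ne_zero |>.1
    ((mul_eq_zero.1 (hdiss x)).resolve_left (hηpos _ (hpos x)).ne')
end

section
/- Explicit coupled traveling front for α = β: let α > 0 and κ₀ ∈ (0, 1/2). Then the functions V(z) = √(2 − 4κ₀)·(2αz)^{1/(2α)} and W(z) = (2αz)^{1/α} satisfy, for all z > 0, the integrated front equations V(z) = W(z)^α V'(z) and W(z) − ½V(z)² = κ₀ W(z)^α W'(z) (front speed c_F = 1), and (V(z), W(z)) → (0,0) as z → 0⁺. -/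
open Set

/-- Multiplying the derivative of `x ↦ (c x) ^ p` by its base recovers `(c x) ^ p` up to `c p`. -/
theorem mul_deriv_const_mul_rpow (c p : ℝ) {z : ℝ} (h : 0 < c * z) :
    c * z * deriv (fun x : ℝ => (c * x) ^ p) z = c * p * (c * z) ^ p := by
  have hd : HasDerivAt (fun x : ℝ => (c * x) ^ p) (c * p * (c * z) ^ (p - 1)) z := by
    simpa using ((hasDerivAt_id z).const_mul c).rpow_const (p := p) (Or.inl h.ne')
  rw [hd.deriv, Real.rpow_sub_one h.ne', mul_left_comm, mul_div_cancel₀ _ h.ne']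

/-- For `p > 0`, the function `x ↦ (c x) ^ p` tends to `0` at `0`. -/
theorem tendsto_const_mul_rpow_nhds_zero (c : ℝ) {p : ℝ} (hp : 0 < p) :
    Filter.Tendsto (fun x : ℝ => (c * x) ^ p) (nhds 0) (nhds 0) := by
  have h : Continuous fun x : ℝ => (c * x) ^ p :=
    (continuous_const.mul continuous_id).rpow_const fun _ => Or.inr hp.le
  simpa [Real.zero_rpow hp.ne'] using h.tendsto 0

/-- Explicit coupled traveling front for `α = β`: for `α > 0` and
`κ₀ ∈ (0, 1/2)`, the functions `V(z) = √(2−4κ₀)·(2αz)^{1/(2α)}`, `W(z) = (2αz)^{1/α}`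
satisfy for all `z > 0` the integrated front equations `V = W^α V'` and
`W − ½V² = κ₀ W^α W'` (front speed `c_F = 1`), and `(V, W) → (0,0)` as `z → 0⁺`. -/
theorem explicit_coupled_front (α κ₀ : ℝ) (hα : 0 < α) (hκ₀ : κ₀ ∈ Ioo (0 : ℝ) (1 / 2)) :
    (∀ z : ℝ, 0 < z →
      (Real.sqrt (2 - 4 * κ₀) * (2 * α * z) ^ (1 / (2 * α))
          = ((2 * α * z) ^ (1 / α)) ^ α
            * deriv (fun z' : ℝ => Real.sqrt (2 - 4 * κ₀) * (2 * α * z') ^ (1 / (2 * α))) z ∧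
       (2 * α * z) ^ (1 / α)
            - (Real.sqrt (2 - 4 * κ₀) * (2 * α * z) ^ (1 / (2 * α))) ^ 2 / 2
          = κ₀ * ((2 * α * z) ^ (1 / α)) ^ α
            * deriv (fun z' : ℝ => (2 * α * z') ^ (1 / α)) z)) ∧
    Filter.Tendsto
      (fun z : ℝ => (Real.sqrt (2 - 4 * κ₀) * (2 * α * z) ^ (1 / (2 * α)),
                     (2 * α * z) ^ (1 / α)))
      (nhdsWithin 0 (Ioi 0)) (nhds ((0 : ℝ), (0 : ℝ))) := by
  have hp : 0 < 1 / α := by positivity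
  have hq : 0 < 1 / (2 * α) := by positivity
  refine ⟨fun z hz => ?_, ?_⟩
  · have hx : 0 < 2 * α * z := by positivity
    have hW : ((2 * α * z) ^ (1 / α)) ^ α = 2 * α * z := by
      rw [← Real.rpow_mul hx.le, one_div_mul_cancel hα.ne', Real.rpow_one]
    have hV : ((2 * α * z) ^ (1 / (2 * α))) ^ 2 = (2 * α * z) ^ (1 / α) := by
      rw [← Real.rpow_mul_natCast hx.le]
      congr 1
      push_cast
      field_simp
    have hs : Real.sqrt (2 - 4 * κ₀) ^ 2 = 2 - 4 * κ₀ :=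
      Real.sq_sqrt (by linarith [hκ₀.2])
    rw [hW]
    constructor
    · rw [deriv_const_mul_field, mul_left_comm, mul_deriv_const_mul_rpow _ _ hx,
        mul_one_div_cancel (by positivity), one_mul]
    · rw [mul_assoc κ₀, mul_deriv_const_mul_rpow _ _ hx, mul_pow, hV, hs]
      field_simp
      ring
  · refine Filter.Tendsto.mono_left (Filter.Tendsto.prodMk_nhds ?_ ?_) nhdsWithin_le_nhds
    · simpa using (tendsto_const_mul_rpow_nhds_zero (2 * α) hq).const_mul (Real.sqrt (2 - 4 * κ₀))
    · exact tendsto_const_mul_rpow_nhds_zero (2 * α) hp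
end

section
/- Lemma 5.2 (matrix positivity for higher L^p estimates): for every integer m ≥ 1 and every κ₀ > 0 there exist coefficients a₁, …, a_m ≥ 0 such that the polynomial φ(v,w) = w^m + Σ_{j=1}^m a_j w^{m−j} v^{2j} satisfies: for all v ∈ ℝ and all w ≥ 0 the symmetric 2×2 matrix 𝔸 with entries 𝔸₁₁ = ∂²φ/∂v² − ∂φ/∂w, 𝔸₁₂ = 𝔸₂₁ = ((1+κ₀)/2)·∂²φ/∂v∂w, and 𝔸₂₂ = κ₀·∂²φ/∂w², evaluated at (v,w), is positive semidefinite. -/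
/-- First partial derivative of `φ : ℝ → ℝ → ℝ` in the first variable. -/
noncomputable def dv (φ : ℝ → ℝ → ℝ) (a b : ℝ) : ℝ := deriv (fun s => φ s b) a
/-- First partial derivative in the second variable. -/
noncomputable def dw (φ : ℝ → ℝ → ℝ) (a b : ℝ) : ℝ := deriv (fun s => φ a s) b
/-- Second partial derivative `φ_{vv}`. -/
noncomputable def dvv (φ : ℝ → ℝ → ℝ) (a b : ℝ) : ℝ := deriv (fun s => dv φ s b) a
/-- Mixed second partial derivative `φ_{vw}`. -/
noncomputable def dvw (φ : ℝ → ℝ → ℝ) (a b : ℝ) : ℝ := deriv (fun s => dv φ a s) b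
/-- Second partial derivative `φ_{ww}`. -/
noncomputable def dww (φ : ℝ → ℝ → ℝ) (a b : ℝ) : ℝ := deriv (fun s => dw φ a s) b

/-- The derivative of a finite sum of monomials, taken termwise. -/
theorem deriv_sum_mul_pow {ι : Type*} (s : Finset ι) (c : ι → ℝ) (p : ι → ℕ) (x : ℝ) :
    deriv (fun t => ∑ j ∈ s, c j * t ^ p j) x = ∑ j ∈ s, c j * (p j * x ^ (p j - 1)) :=
  (HasDerivAt.fun_sum fun j _ => (hasDerivAt_pow (p j) x).const_mul (c j)).deriv

/-- The derivative of a finite sum of monomials with coefficients on both sides. -/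
theorem deriv_sum_mul_pow_mul {ι : Type*} (s : Finset ι) (c d : ι → ℝ) (p : ι → ℕ) (x : ℝ) :
    deriv (fun t => ∑ j ∈ s, c j * t ^ p j * d j) x =
      ∑ j ∈ s, c j * (p j * x ^ (p j - 1)) * d j :=
  (HasDerivAt.fun_sum fun j _ =>
    ((hasDerivAt_pow (p j) x).const_mul (c j)).mul_const (d j)).deriv

/-- Coefficients growing fast enough for each quadratic form in the decomposition of the matrix
to have nonpositive discriminant. -/
noncomputable def lpCoeff (m : ℕ) (κ₀ : ℝ) : ℕ → ℝ
  | 0 => 1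
  | 1 => m
  | n + 2 => lpCoeff m κ₀ (n + 1) * m +
      ((1 + κ₀) * lpCoeff m κ₀ (n + 1) * (n + 1) * m) ^ 2 / (κ₀ * lpCoeff m κ₀ n)

theorem lpCoeff_pos {m : ℕ} (hm : 1 ≤ m) {κ₀ : ℝ} (hκ₀ : 0 < κ₀) (n : ℕ) :
    0 < lpCoeff m κ₀ n := by
  have hm' : (0 : ℝ) < m := by exact_mod_cast hm
  induction n using Nat.twoStepInduction with
  | zero => simp [lpCoeff]
  | one => simpa [lpCoeff] using hm'
  | more n h₀ h₁ => rw [lpCoeff]; positivity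

theorem quadratic_form_nonneg {A B C : ℝ} (hC : 0 < C) (h : B ^ 2 ≤ A * C) (x y : ℝ) :
    0 ≤ A * x ^ 2 + 2 * B * x * y + C * y ^ 2 := by
  have key : 0 ≤ C * (A * x ^ 2 + 2 * B * x * y + C * y ^ 2) := by
    nlinarith [sq_nonneg (B * x + C * y), mul_nonneg (sub_nonneg.2 h) (sq_nonneg x)]
  exact nonneg_of_mul_nonneg_right key hC

/-- The discriminant inequality satisfied by `lpCoeff`, where `d` stands for `m - k - 1`. -/
theorem lpCoeff_discrim {m : ℕ} (hm : 1 ≤ m) {κ₀ : ℝ} (hκ₀ : 0 < κ₀) (k : ℕ) {d : ℝ}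
    (hd : 1 ≤ d) (hdm : d ≤ m) :
    ((1 + κ₀) * lpCoeff m κ₀ (k + 1) * (k + 1) * d) ^ 2 ≤
      (lpCoeff m κ₀ (k + 2) * ((2 * k + 4) * (2 * k + 3)) - lpCoeff m κ₀ (k + 1) * d) *
        (κ₀ * (lpCoeff m κ₀ k * ((d + 1) * d))) := by
  have h₀ := lpCoeff_pos hm hκ₀ k
  have h₁ := lpCoeff_pos hm hκ₀ (k + 1)
  have h₂ := lpCoeff_pos hm hκ₀ (k + 2)
  have hk : (0 : ℝ) ≤ k := k.cast_nonneg
  set q := ((1 + κ₀) * lpCoeff m κ₀ (k + 1) * (k + 1) * m) ^ 2 with hq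
  have hrec : lpCoeff m κ₀ (k + 2) = lpCoeff m κ₀ (k + 1) * m + q / (κ₀ * lpCoeff m κ₀ k) := by
    rw [lpCoeff]
  have hα : q / (κ₀ * lpCoeff m κ₀ k) ≤
      lpCoeff m κ₀ (k + 2) * ((2 * k + 4) * (2 * k + 3)) - lpCoeff m κ₀ (k + 1) * d := by
    have e₁ : lpCoeff m κ₀ (k + 2) * 1 ≤ lpCoeff m κ₀ (k + 2) * ((2 * k + 4) * (2 * k + 3)) :=
      mul_le_mul_of_nonneg_left (by nlinarith) h₂.le
    have e₂ := mul_le_mul_of_nonneg_left hdm h₁.le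
    linarith
  calc ((1 + κ₀) * lpCoeff m κ₀ (k + 1) * (k + 1) * d) ^ 2 ≤ q := by
        rw [hq]; gcongr
    _ = q / (κ₀ * lpCoeff m κ₀ k) * (κ₀ * (lpCoeff m κ₀ k * 1)) := by field_simp
    _ ≤ _ := by
        have : 1 ≤ (d + 1) * d := by nlinarith
        have : 0 ≤ q := sq_nonneg _
        gcongr
        exact le_trans (by positivity) hα

section PartialDerivatives

variable (a : ℕ → ℝ) (n : ℕ)

/-- The homogeneous polynomial `∑ j ≤ n + 1, a j * w ^ (n + 1 - j) * v ^ (2 * j)`. -/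
noncomputable def evenForm (v w : ℝ) : ℝ :=
  ∑ j ∈ Finset.range (n + 2), a j * w ^ (n + 1 - j) * v ^ (2 * j)

theorem dv_evenForm (v w : ℝ) : dv (evenForm a n) v w =
    ∑ j ∈ Finset.range (n + 2), a j * w ^ (n + 1 - j) * ((2 * j : ℕ) * v ^ (2 * j - 1)) :=
  deriv_sum_mul_pow _ (fun j => a j * w ^ (n + 1 - j)) _ v

theorem dvv_evenForm (v w : ℝ) : dvv (evenForm a n) v w =
    ∑ j ∈ Finset.range (n + 1),
      a (j + 1) * ((2 * j + 2) * (2 * j + 1)) * w ^ (n - j) * v ^ (2 * j) := by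
  have h := deriv_sum_mul_pow (Finset.range (n + 2))
    (fun j => a j * w ^ (n + 1 - j) * (2 * j : ℕ)) (fun j => 2 * j - 1) v
  simp only [dvv, dv_evenForm, ← mul_assoc] at h ⊢
  rw [h, Finset.sum_range_succ']
  simp only [Nat.cast_zero, mul_zero, zero_mul, add_zero]
  refine Finset.sum_congr rfl fun j _ => ?_
  rw [show 2 * (j + 1) - 1 = 2 * j + 1 by lia, Nat.add_sub_cancel, Nat.add_sub_add_right]
  push_cast
  ring

theorem dw_evenForm (v w : ℝ) : dw (evenForm a n) v w =
    ∑ j ∈ Finset.range (n + 1), a j * (n + 1 - j : ℕ) * w ^ (n - j) * v ^ (2 * j) := by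
  have h := deriv_sum_mul_pow_mul (Finset.range (n + 2)) a (fun j => v ^ (2 * j))
    (fun j => n + 1 - j) w
  simp only [dw, evenForm]
  rw [h, Finset.sum_range_succ]
  simp only [Nat.sub_self, Nat.cast_zero, mul_zero, zero_mul, add_zero]
  refine Finset.sum_congr rfl fun j _ => ?_
  rw [show n + 1 - j - 1 = n - j by lia]
  ring

theorem dvw_evenForm (v w : ℝ) : dvw (evenForm a n) v w =
    ∑ k ∈ Finset.range n,
      a (k + 1) * (2 * (k + 1)) * (n - k : ℕ) * w ^ (n - 1 - k) * v ^ (2 * k + 1) := by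
  have h := deriv_sum_mul_pow_mul (Finset.range (n + 2)) a
    (fun j => (2 * j : ℕ) * v ^ (2 * j - 1)) (fun j => n + 1 - j) w
  simp only [dvw, dv_evenForm]
  rw [h, Finset.sum_range_succ', Finset.sum_range_succ]
  simp only [Nat.sub_self, Nat.cast_zero, mul_zero, zero_mul, add_zero]
  refine Finset.sum_congr rfl fun k _ => ?_
  rw [show 2 * (k + 1) - 1 = 2 * k + 1 by lia, Nat.add_sub_add_right,
    show n - k - 1 = n - 1 - k by lia]
  push_cast
  ring

theorem dww_evenForm (v w : ℝ) : dww (evenForm a n) v w =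
    ∑ k ∈ Finset.range n,
      a k * ((n + 1 - k : ℕ) * (n - k : ℕ)) * w ^ (n - 1 - k) * v ^ (2 * k) := by
  have h := deriv_sum_mul_pow_mul (Finset.range (n + 1))
    (fun j => a j * (n + 1 - j : ℕ)) (fun j => v ^ (2 * j)) (fun j => n - j) w
  simp only [dww, dw_evenForm]
  rw [h, Finset.sum_range_succ]
  simp only [Nat.sub_self, Nat.cast_zero, mul_zero, zero_mul, add_zero]
  refine Finset.sum_congr rfl fun k _ => ?_
  rw [show n - k - 1 = n - 1 - k by lia]
  ring

/-- Decomposition of the quadratic form of the matrix into binary forms in `(v * x, y)`. -/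
theorem quadratic_form_evenForm (κ₀ v w x y : ℝ) :
    (dvv (evenForm a n) v w - dw (evenForm a n) v w) * x ^ 2 +
        (1 + κ₀) * dvw (evenForm a n) v w * x * y + κ₀ * dww (evenForm a n) v w * y ^ 2 =
      (a 1 * 2 - a 0 * (n + 1)) * w ^ n * x ^ 2 +
        ∑ k ∈ Finset.range n, w ^ (n - 1 - k) * v ^ (2 * k) *
          ((a (k + 2) * ((2 * k + 4) * (2 * k + 3)) - a (k + 1) * (n - k : ℕ)) * (v * x) ^ 2 +
            2 * ((1 + κ₀) * a (k + 1) * (k + 1) * (n - k : ℕ)) * (v * x) * y +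
            κ₀ * (a k * (((n - k : ℕ) + 1) * (n - k : ℕ))) * y ^ 2) := by
  rw [dvv_evenForm, dw_evenForm, dvw_evenForm, dww_evenForm, Finset.sum_range_succ',
    Finset.sum_range_succ']
  have hsum : ∀ f g : ℕ → ℝ, ∀ p q : ℝ, ∑ k ∈ Finset.range n, f k + p -
      (∑ k ∈ Finset.range n, g k + q) = p - q + (∑ k ∈ Finset.range n, (f k - g k)) := by
    intro f g p q
    rw [Finset.sum_sub_distrib]
    ring
  rw [hsum, add_mul, add_assoc, add_assoc]
  congr 1
  · simp only [Nat.sub_zero, mul_zero, pow_zero, Nat.cast_zero, Nat.cast_add, Nat.cast_one]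
    ring
  · simp only [Finset.mul_sum, Finset.sum_mul, ← Finset.sum_add_distrib]
    refine Finset.sum_congr rfl fun k hk => ?_
    have hk := Finset.mem_range.1 hk
    rw [show n - (k + 1) = n - 1 - k by lia, Nat.add_sub_add_right,
      show n + 1 - k = n - k + 1 by lia]
    push_cast
    ring

end PartialDerivatives

theorem posSemidef_fin_two_of_nonneg {A B C : ℝ}
    (h : ∀ x y : ℝ, 0 ≤ A * x ^ 2 + 2 * B * x * y + C * y ^ 2) :
    Matrix.PosSemidef !![A, B; B, C] := by
  refine Matrix.PosSemidef.of_dotProduct_mulVec_nonneg ?_ fun z => ?_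
  · ext i j
    fin_cases i <;> fin_cases j <;> rfl
  · refine (h (z 0) (z 1)).trans_eq ?_
    simp only [dotProduct, Matrix.mulVec, Fin.sum_univ_two, Pi.star_apply, star_trivial,
      Matrix.of_apply, Matrix.cons_val_zero, Matrix.cons_val_one]
    ring

/-- Lemma 5.2: for every integer `m ≥ 1` and `κ₀ > 0` there are
coefficients `a₁, …, a_m ≥ 0` such that `φ(v,w) = w^m + ∑_{j=1}^m a_j w^{m−j} v^{2j}`
makes the matrix `𝔸 = [[φ_{vv} − φ_w, ((1+κ₀)/2)φ_{vw}], [((1+κ₀)/2)φ_{vw}, κ₀ φ_{ww}]]`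
positive semidefinite for all `v ∈ ℝ`, `w ≥ 0`. -/
theorem matrix_positivity_higher_Lp (m : ℕ) (hm : 1 ≤ m) (κ₀ : ℝ) (hκ₀ : 0 < κ₀) :
    ∃ a : ℕ → ℝ, (∀ j ∈ Finset.Icc 1 m, 0 ≤ a j) ∧
      ∀ φ : ℝ → ℝ → ℝ,
        (φ = fun v w => w ^ m + ∑ j ∈ Finset.Icc 1 m, a j * w ^ (m - j) * v ^ (2 * j)) →
        ∀ v w : ℝ, 0 ≤ w →
          Matrix.PosSemidef
            !![dvv φ v w - dw φ v w, (1 + κ₀) / 2 * dvw φ v w ;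
               (1 + κ₀) / 2 * dvw φ v w, κ₀ * dww φ v w] := by
  refine ⟨lpCoeff m κ₀, fun j _ => (lpCoeff_pos hm hκ₀ j).le, fun φ hφ v w hw => ?_⟩
  obtain ⟨n, rfl⟩ : ∃ n, m = n + 1 := ⟨m - 1, by lia⟩
  have hform : φ = evenForm (lpCoeff (n + 1) κ₀) n := by
    rw [hφ]
    funext v w
    rw [evenForm, Finset.sum_range_succ', add_comm, ← Finset.Ico_add_one_right_eq_Icc,
      Finset.sum_Ico_eq_sum_range]
    simp [lpCoeff, add_comm 1]
  rw [hform]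
  refine posSemidef_fin_two_of_nonneg fun x y => ?_
  have hquad := quadratic_form_evenForm (lpCoeff (n + 1) κ₀) n κ₀ v w x y
  rw [show 2 * ((1 + κ₀) / 2 * dvw (evenForm (lpCoeff (n + 1) κ₀) n) v w) =
    (1 + κ₀) * dvw (evenForm (lpCoeff (n + 1) κ₀) n) v w by ring, hquad]
  refine add_nonneg ?_ (Finset.sum_nonneg fun k hk => ?_)
  · have : 0 ≤ lpCoeff (n + 1) κ₀ 1 * 2 - lpCoeff (n + 1) κ₀ 0 * (n + 1) := by
      simp only [lpCoeff]
      push_cast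
      linarith [n.cast_nonneg (α := ℝ)]
    positivity
  · have hk := Finset.mem_range.1 hk
    have hd : (1 : ℝ) ≤ (n - k : ℕ) := by exact_mod_cast (by lia : 1 ≤ n - k)
    have hdm : ((n - k : ℕ) : ℝ) ≤ (n + 1 : ℕ) := by exact_mod_cast (by lia : n - k ≤ n + 1)
    have h₀ := lpCoeff_pos hm hκ₀ k
    have hv : 0 ≤ v ^ (2 * k) := by rw [pow_mul]; positivity
    exact mul_nonneg (mul_nonneg (pow_nonneg hw _) hv)
      (quadratic_form_nonneg (by positivity) (lpCoeff_discrim hm hκ₀ k hd hdm) _ _)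
end

section
/- Reduction for η ≡ κ via e = Bv (Section 4.4): let κ : [0,∞) → ℝ be continuously differentiable, B > 0, and define κ̃_B(v) := κ(Bv − ½v²). Let v be a C² classical solution of ∂_t v = div(κ̃_B(v)∇v) on an open set U ⊆ ℝ × ℝ^d with 0 ≤ v(t,x) ≤ 2B everywhere. Then the pair (v, w) with w := Bv − ½v² satisfies w ≥ 0 and is a classical solution of the coupled system ∂_t v = div(κ(w)∇v), ∂_t w = div(κ(w)∇w) + κ(w)|∇v|² on U. -/
open Set

/-- Spatial partial derivative in direction `i`. -/
noncomputable def pderiv' {d : ℕ} (f : (Fin d → ℝ) → ℝ) (i : Fin d) (x : Fin d → ℝ) : ℝ :=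
  fderiv ℝ f x (Pi.single i 1)

/-- A function that is differentiable within `s` can be composed with a differentiable function
which stays in `s` near the base point, even if its value there lies on the boundary of `s`. -/
theorem DifferentiableOn.differentiableAt_comp_of_eventually_mem
    {E F G : Type*} [NormedAddCommGroup E] [NormedSpace ℝ E] [NormedAddCommGroup F]
    [NormedSpace ℝ F] [NormedAddCommGroup G] [NormedSpace ℝ G] {g : F → G} {s : Set F}
    (hg : DifferentiableOn ℝ g s) {f : E → F} {x : E} (hf : DifferentiableAt ℝ f x)
    (hs : ∀ᶠ y in nhds x, f y ∈ s) : DifferentiableAt ℝ (fun y => g (f y)) x := by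
  have h : DifferentiableWithinAt ℝ (g ∘ f) (f ⁻¹' s) x :=
    (hg (f x) hs.self_of_nhds).comp x hf.differentiableWithinAt (mapsTo_preimage f s)
  exact h.differentiableAt hs

theorem ContDiffAt.differentiableAt_pderiv' {d : ℕ} {f : (Fin d → ℝ) → ℝ} {x : Fin d → ℝ}
    (hf : ContDiffAt ℝ 2 f x) (i : Fin d) : DifferentiableAt ℝ (pderiv' f i) x :=
  ((hf.fderiv_right (m := 1) (by norm_num)).differentiableAt one_ne_zero).clm_apply
    (differentiableAt_const _)

theorem pderiv'_mul {d : ℕ} {f g : (Fin d → ℝ) → ℝ} {x : Fin d → ℝ}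
    (hf : DifferentiableAt ℝ f x) (hg : DifferentiableAt ℝ g x) (i : Fin d) :
    pderiv' (fun y => f y * g y) i x = f x * pderiv' g i x + g x * pderiv' f i x := by
  simp [pderiv', fderiv_fun_mul hf hg]

theorem pderiv'_const_sub {d : ℕ} (f : (Fin d → ℝ) → ℝ) (B : ℝ) (x : Fin d → ℝ) (i : Fin d) :
    pderiv' (fun y => B - f y) i x = -pderiv' f i x := by
  simp [pderiv', fderiv_const_sub]

theorem hasDerivAt_const_mul_sub_sq_div_two (B u : ℝ) :
    HasDerivAt (fun u : ℝ => B * u - u ^ 2 / 2) (B - u) u := by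
  refine (((hasDerivAt_id' u).const_mul B).fun_sub
    ((hasDerivAt_pow 2 u).div_const 2)).congr_deriv ?_
  norm_num

theorem pderiv'_const_mul_sub_sq_div_two {d : ℕ} {f : (Fin d → ℝ) → ℝ} {x : Fin d → ℝ}
    (hf : DifferentiableAt ℝ f x) (B : ℝ) (i : Fin d) :
    pderiv' (fun y => B * f y - (f y) ^ 2 / 2) i x = (B - f x) * pderiv' f i x := by
  have h : HasFDerivAt (fun y => B * f y - (f y) ^ 2 / 2) ((B - f x) • fderiv ℝ f x) x :=
    (hasDerivAt_const_mul_sub_sq_div_two B (f x)).comp_hasFDerivAt x hf.hasFDerivAt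
  simp [pderiv', h.fderiv]

/-- Section 4.4: reduction for `η ≡ κ` via `e = Bv`.  Let `κ` be C¹ on
`[0,∞)`, `B > 0`, and `κ̃_B(v) := κ(Bv − ½v²)`.  If `v` is a C² classical solution of
`∂ₜ v = div(κ̃_B(v)∇v)` on an open set `U` with `0 ≤ v ≤ 2B`, then `w := Bv − ½v²` is
nonnegative and `(v, w)` is a classical solution of the coupled system
`∂ₜ v = div(κ(w)∇v)`, `∂ₜ w = div(κ(w)∇w) + κ(w)|∇v|²` on `U`. -/
theorem eta_eq_kappa_reduction
    {d : ℕ} (κ : ℝ → ℝ) (hκ : ContDiffOn ℝ 1 κ (Ici 0)) (B : ℝ) (hB : 0 < B)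
    (U : Set (ℝ × (Fin d → ℝ))) (hU : IsOpen U)
    (v : ℝ → (Fin d → ℝ) → ℝ)
    (hv : ContDiffOn ℝ 2 (fun p : ℝ × (Fin d → ℝ) => v p.1 p.2) U)
    (hrange : ∀ t x, (t, x) ∈ U → v t x ∈ Icc 0 (2 * B))
    (heq : ∀ t x, (t, x) ∈ U →
      deriv (fun s => v s x) t
        = ∑ i, pderiv' (fun y => κ (B * v t y - (v t y) ^ 2 / 2) * pderiv' (v t) i y) i x) :
    ∀ t x, (t, x) ∈ U →
      0 ≤ B * v t x - (v t x) ^ 2 / 2 ∧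
      deriv (fun s => v s x) t
        = ∑ i, pderiv' (fun y => κ (B * v t y - (v t y) ^ 2 / 2) * pderiv' (v t) i y) i x ∧
      deriv (fun s => B * v s x - (v s x) ^ 2 / 2) t
        = ∑ i, pderiv' (fun y => κ (B * v t y - (v t y) ^ 2 / 2)
              * pderiv' (fun y' => B * v t y' - (v t y') ^ 2 / 2) i y) i x
          + κ (B * v t x - (v t x) ^ 2 / 2) * ∑ i, (pderiv' (v t) i x) ^ 2 := by
  intro t x hx
  have hvC : ∀ y, (t, y) ∈ U → ContDiffAt ℝ 2 (v t) y := fun y hy =>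
    (hv.contDiffAt (hU.mem_nhds hy)).comp (f := fun z => (t, z)) y
      (contDiffAt_const.prodMk contDiffAt_id)
  have hvD : ∀ y, (t, y) ∈ U → DifferentiableAt ℝ (v t) y := fun y hy =>
    (hvC y hy).differentiableAt two_ne_zero
  have hnhds : ∀ᶠ y in nhds x, (t, y) ∈ U :=
    (Continuous.prodMk_right t).continuousAt.eventually (hU.mem_nhds hx)
  have hw : ∀ y, (t, y) ∈ U → 0 ≤ B * v t y - (v t y) ^ 2 / 2 := fun y hy => by
    obtain ⟨h0, h1⟩ := hrange t y hy
    nlinarith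
  have hκw : DifferentiableAt ℝ (fun y => κ (B * v t y - (v t y) ^ 2 / 2)) x :=
    (hκ.differentiableOn one_ne_zero).differentiableAt_comp_of_eventually_mem
      ((hasDerivAt_const_mul_sub_sq_div_two B (v t x)).comp_hasFDerivAt x
        (hvD x hx).hasFDerivAt).differentiableAt
      (hnhds.mono hw)
  refine ⟨hw x hx, heq t x hx, ?_⟩
  have hdiv : ∀ i, pderiv' (fun y => κ (B * v t y - (v t y) ^ 2 / 2)
      * pderiv' (fun y' => B * v t y' - (v t y') ^ 2 / 2) i y) i x
      = (B - v t x) * pderiv' (fun y => κ (B * v t y - (v t y) ^ 2 / 2) * pderiv' (v t) i y) i x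
        - κ (B * v t x - (v t x) ^ 2 / 2) * (pderiv' (v t) i x) ^ 2 := fun i => by
    have hcongr : (fun y => κ (B * v t y - (v t y) ^ 2 / 2)
        * pderiv' (fun y' => B * v t y' - (v t y') ^ 2 / 2) i y) =ᶠ[nhds x]
        fun y => (B - v t y) * (κ (B * v t y - (v t y) ^ 2 / 2) * pderiv' (v t) i y) := by
      filter_upwards [hnhds] with y hy
      rw [pderiv'_const_mul_sub_sq_div_two (hvD y hy)]
      ring
    have hflux := hκw.fun_mul ((hvC x hx).differentiableAt_pderiv' i)
    calc _ = pderiv' (fun y => (B - v t y)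
            * (κ (B * v t y - (v t y) ^ 2 / 2) * pderiv' (v t) i y)) i x := by
          simp only [pderiv'] at hcongr ⊢
          rw [hcongr.fderiv_eq]
      _ = _ := by
          rw [pderiv'_mul ((hvD x hx).const_sub B) hflux, pderiv'_const_sub]
          ring
  have hvt : HasDerivAt (fun s => v s x) (deriv (fun s => v s x) t) t := by
    have h : DifferentiableAt ℝ (fun s => v s x) t :=
      ((hv.contDiffAt (hU.mem_nhds hx)).differentiableAt two_ne_zero).comp
        (f := fun s => (s, x)) t (differentiableAt_id.prodMk (differentiableAt_const x))
    exact h.hasDerivAt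
  have hwt : deriv (fun s => B * v s x - (v s x) ^ 2 / 2) t
      = (B - v t x) * deriv (fun s => v s x) t :=
    ((hasDerivAt_const_mul_sub_sq_div_two B (v t x)).comp (h := fun s => v s x) t hvt).deriv
  rw [hwt, heq t x hx, Finset.sum_congr rfl fun i _ => hdiv i, Finset.sum_sub_distrib,
    ← Finset.mul_sum, ← Finset.mul_sum]
  ring
end

section
/- Explicit compactly supported solution (Section 4.2), interior verification: let B, x_*, t_* > 0 and set T = t + t_*. On the open region { (t,x) ∈ (0,∞) × ℝ : |x + x_*| < 2B√T }, the functions v(t,x) = (x + x_* + 2B√T)/(√2 √T) and w(t,x) = B² − (x + x_*)²/(4T) satisfy w > 0 and solve the one-dimensional coupled system ∂_t v = ∂_x(w ∂_x v) and ∂_t w = ∂_x(w ∂_x w) + w (∂_x v)² pointwise. -/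
/-- Section 4.2, interior verification: on the open region
`{(t,x) : t > 0, |x + x_*| < 2B√(t+t_*)}`, the functions
`v(t,x) = (x + x_* + 2B√(t+t_*))/(√2√(t+t_*))` and `w(t,x) = B² − (x+x_*)²/(4(t+t_*))`
satisfy `w > 0` and solve `∂ₜ v = ∂ₓ(w∂ₓ v)`, `∂ₜ w = ∂ₓ(w∂ₓ w) + w(∂ₓ v)²` pointwise. -/
theorem explicit_compactly_supported_solution_interior
    (B xstar tstar : ℝ) (hB : 0 < B) (hx : 0 < xstar) (ht : 0 < tstar) :
    ∀ t x : ℝ, 0 < t → |x + xstar| < 2 * B * Real.sqrt (t + tstar) →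
      (0 < B ^ 2 - (x + xstar) ^ 2 / (4 * (t + tstar)) ∧
       deriv (fun s => (x + xstar + 2 * B * Real.sqrt (s + tstar))
            / (Real.sqrt 2 * Real.sqrt (s + tstar))) t
         = deriv (fun y => (B ^ 2 - (y + xstar) ^ 2 / (4 * (t + tstar)))
             * deriv (fun y' => (y' + xstar + 2 * B * Real.sqrt (t + tstar))
                 / (Real.sqrt 2 * Real.sqrt (t + tstar))) y) x ∧
       deriv (fun s => B ^ 2 - (x + xstar) ^ 2 / (4 * (s + tstar))) t
         = deriv (fun y => (B ^ 2 - (y + xstar) ^ 2 / (4 * (t + tstar)))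
             * deriv (fun y' => B ^ 2 - (y' + xstar) ^ 2 / (4 * (t + tstar))) y) x
           + (B ^ 2 - (x + xstar) ^ 2 / (4 * (t + tstar)))
             * (deriv (fun y' => (y' + xstar + 2 * B * Real.sqrt (t + tstar))
                 / (Real.sqrt 2 * Real.sqrt (t + tstar))) x) ^ 2) := by
  intro t x h0 hX
  have hT : 0 < t + tstar := add_pos h0 ht
  have hr : 0 < √(t + tstar) := Real.sqrt_pos.2 hT
  have hrT : √(t + tstar) ^ 2 = t + tstar := Real.sq_sqrt hT.le
  have h2 : 0 < √(2 : ℝ) := Real.sqrt_pos.2 two_pos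
  have h2sq : √(2 : ℝ) ^ 2 = 2 := Real.sq_sqrt zero_le_two
  have hvx (y : ℝ) : HasDerivAt (fun y' => (y' + xstar + 2 * B * √(t + tstar))
      / (√2 * √(t + tstar))) (1 / (√2 * √(t + tstar))) y :=
    (((hasDerivAt_id y).add_const xstar).add_const _).div_const _
  have hwx (y : ℝ) : HasDerivAt (fun y' => B ^ 2 - (y' + xstar) ^ 2 / (4 * (t + tstar)))
      (-(y + xstar) / (2 * (t + tstar))) y := by
    refine (((((hasDerivAt_id' y).add_const xstar).fun_pow 2).div_const
      (4 * (t + tstar))).const_sub (B ^ 2)).congr_deriv ?_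
    field_simp
    norm_num
    ring
  have hwwx : HasDerivAt (fun y => (B ^ 2 - (y + xstar) ^ 2 / (4 * (t + tstar)))
      * (-(y + xstar) / (2 * (t + tstar))))
      (-(x + xstar) / (2 * (t + tstar)) * (-(x + xstar) / (2 * (t + tstar)))
        + (B ^ 2 - (x + xstar) ^ 2 / (4 * (t + tstar))) * (-1 / (2 * (t + tstar)))) x :=
    (hwx x).mul (((hasDerivAt_id x).add_const xstar).neg.div_const _)
  have hst : HasDerivAt (fun s => s + tstar) 1 t := (hasDerivAt_id t).add_const tstar
  have hsqrt := hst.sqrt hT.ne'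
  have hvt := ((hsqrt.const_mul (2 * B)).const_add (x + xstar)).fun_div
    (hsqrt.const_mul √2) (mul_pos h2 hr).ne'
  have hwt := ((hasDerivAt_const t ((x + xstar) ^ 2)).fun_div (hst.const_mul 4)
    (mul_pos four_pos hT).ne').const_sub (B ^ 2)
  refine ⟨?_, ?_, ?_⟩
  · rw [sub_pos, div_lt_iff₀ (by positivity), ← sq_abs, ← hrT]
    nlinarith [pow_lt_pow_left₀ hX (abs_nonneg _) two_ne_zero]
  · simp only [fun y => (hvx y).deriv]
    rw [hvt.deriv, ((hwx x).mul_const _).deriv, ← hrT, Real.sqrt_sq hr.le]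
    field_simp
    ring
  · simp only [fun y => (hwx y).deriv]
    rw [hwt.deriv, hwwx.deriv, (hvx x).deriv, div_pow 1, mul_pow √2, h2sq, hrT]
    field_simp
    ring
end

section
/- Integral identities for the explicit solution: let B, x_*, t_* > 0 with t_* < x_*²/(4B²), and let (v*, w*) be the explicit piecewise solution defined by v*(t,x) = (x + x_* + 2B√(t+t_*))/(√2√(t+t_*)) for |x + x_*| ≤ 2B√(t+t_*), v* = 2√2 B for |x| ≤ x_* − 2B√(t+t_*), v*(t,x) = (x_* + 2B√(t+t_*) − x)/(√2√(t+t_*)) for |x − x_*| ≤ 2B√(t+t_*), v* = 0 otherwise; and w*(t,x) = B² − (x ± x_*)²/(4(t+t_*)) for |x ± x_*| ≤ 2B√(t+t_*) and w* = 0 otherwise. Then for every t ∈ [0, x_*²/(4B²) − t_*]: ∫_ℝ v*(t,x) dx = √32·B·x_*, ∫_ℝ ½ v*(t,x)² dx = 8B²x_* − (16/3)B³√(t+t_*), and ∫_ℝ w*(t,x) dx = (16/3)B³√(t+t_*); in particular the total momentum ∫v* dx and total energy ∫(½(v*)² + w*) dx = 8B²x_* are constant in time. -/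
open MeasureTheory

/-- The explicit piecewise function `v*` of Section 4.2. -/
noncomputable def vstar (B xstar tstar : ℝ) (t x : ℝ) : ℝ :=
  if |x + xstar| ≤ 2 * B * Real.sqrt (t + tstar) then
    (x + xstar + 2 * B * Real.sqrt (t + tstar)) / (Real.sqrt 2 * Real.sqrt (t + tstar))
  else if |x| ≤ xstar - 2 * B * Real.sqrt (t + tstar) then
    2 * Real.sqrt 2 * B
  else if |x - xstar| ≤ 2 * B * Real.sqrt (t + tstar) then
    (xstar + 2 * B * Real.sqrt (t + tstar) - x) / (Real.sqrt 2 * Real.sqrt (t + tstar))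
  else 0

/-- The explicit piecewise function `w*` of Section 4.2. -/
noncomputable def wstar (B xstar tstar : ℝ) (t x : ℝ) : ℝ :=
  if |x + xstar| ≤ 2 * B * Real.sqrt (t + tstar) then
    B ^ 2 - (x + xstar) ^ 2 / (4 * (t + tstar))
  else if |x - xstar| ≤ 2 * B * Real.sqrt (t + tstar) then
    B ^ 2 - (x - xstar) ^ 2 / (4 * (t + tstar))
  else 0

theorem intervalIntegral_quadratic (α β γ m a b : ℝ) :
    ∫ x in a..b, (α + β * (x - m) + γ * (x - m) ^ 2) =
      (α * (b - m) + β * (b - m) ^ 2 / 2 + γ * (b - m) ^ 3 / 3) -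
        (α * (a - m) + β * (a - m) ^ 2 / 2 + γ * (a - m) ^ 3 / 3) := by
  refine intervalIntegral.integral_eq_sub_of_hasDerivAt
    (f := fun x => α * (x - m) + β * (x - m) ^ 2 / 2 + γ * (x - m) ^ 3 / 3) (fun x _ => ?_)
    (Continuous.intervalIntegrable (by fun_prop) _ _)
  have h := (hasDerivAt_id x).sub_const m
  have h' := ((h.const_mul α).add (((h.pow 2).const_mul β).div_const 2)).add
    (((h.pow 3).const_mul γ).div_const 3)
  refine h'.congr_deriv ?_
  simp only [id, Nat.cast_ofNat]
  ring

/-- A function that is quadratic on `|x + m| ≤ r` and on `|x - m| ≤ r`, constant in between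
and zero elsewhere is integrable, and its integral is explicit. -/
theorem integrable_and_integral_of_piecewise_quadratic {f : ℝ → ℝ}
    {m r α β γ κ α' β' γ' : ℝ} (hr : 0 ≤ r) (hm : r ≤ m)
    (h₀ : ∀ x, x < -m - r → f x = 0)
    (h₁ : ∀ x, -m - r < x → x ≤ -m + r → f x = α + β * (x + m) + γ * (x + m) ^ 2)
    (h₂ : ∀ x, -m + r < x → x ≤ m - r → f x = κ)
    (h₃ : ∀ x, -m + r < x → m - r < x → x ≤ m + r →
      f x = α' + β' * (x - m) + γ' * (x - m) ^ 2)
    (h₄ : ∀ x, m + r < x → f x = 0) :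
    Integrable f ∧ ∫ x, f x =
      (2 * α * r + 2 * γ * r ^ 3 / 3) + κ * (2 * m - 2 * r) +
        (2 * α' * r + 2 * γ' * r ^ 3 / 3) := by
  set p : ℝ → ℝ := fun x => α + β * (x - -m) + γ * (x - -m) ^ 2 with hp
  set q : ℝ → ℝ := fun x => α' + β' * (x - m) + γ' * (x - m) ^ 2 with hq
  have hab : -m - r ≤ -m + r := by linarith
  have hbc : -m + r ≤ m - r := by linarith
  have hcd : m - r ≤ m + r := by linarith
  have hf : (Set.Ioc (-m - r) (-m + r)).indicator p +
      (Set.Ioc (-m + r) (m - r)).indicator (fun _ => κ) +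
      (Set.Ioc (m - r) (m + r)).indicator q =ᵐ[volume] f := by
    filter_upwards [Measure.ae_ne volume (-m - r)] with x hx
    simp only [Pi.add_apply, Set.indicator_apply, Set.mem_Ioc]
    rcases lt_or_gt_of_ne hx with h | ha
    · rw [h₀ x h, if_neg (by intro h'; linarith [h'.1]), if_neg (by intro h'; linarith [h'.1]),
        if_neg (by intro h'; linarith [h'.1])]
      simp
    rcases le_or_gt x (-m + r) with h | hb
    · rw [h₁ x ha h, if_pos ⟨ha, h⟩, if_neg (by intro h'; linarith [h'.1]),
        if_neg (by intro h'; linarith [h'.1])]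
      simp [hp]
    rcases le_or_gt x (m - r) with h | hc
    · rw [h₂ x hb h, if_neg (by intro h'; linarith [h'.2]), if_pos ⟨hb, h⟩,
        if_neg (by intro h'; linarith [h'.1])]
      simp
    rcases le_or_gt x (m + r) with h | hd
    · rw [h₃ x hb hc h, if_neg (by intro h'; linarith [h'.2]),
        if_neg (by intro h'; linarith [h'.2]), if_pos ⟨hc, h⟩]
      simp [hq]
    · rw [h₄ x hd, if_neg (by intro h'; linarith [h'.2]), if_neg (by intro h'; linarith [h'.2]),
        if_neg (by intro h'; linarith [h'.2])]
      simp
  have hint : ∀ (g : ℝ → ℝ) (a b : ℝ), Continuous g →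
      Integrable ((Set.Ioc a b).indicator g) := fun g a b hg =>
    (integrable_indicator_iff measurableSet_Ioc).2 hg.integrableOn_Ioc
  have hpi := hint p (-m - r) (-m + r) (by fun_prop)
  have hki := hint (fun _ => κ) (-m + r) (m - r) continuous_const
  have hqi := hint q (m - r) (m + r) (by fun_prop)
  refine ⟨((hpi.add hki).add hqi).congr hf, ?_⟩
  rw [← integral_congr_ae hf, integral_add' (hpi.add hki) hqi, integral_add' hpi hki,
    integral_indicator measurableSet_Ioc, integral_indicator measurableSet_Ioc,
    integral_indicator measurableSet_Ioc, ← intervalIntegral.integral_of_le hab,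
    ← intervalIntegral.integral_of_le hbc, ← intervalIntegral.integral_of_le hcd,
    intervalIntegral_quadratic, intervalIntegral_quadratic, intervalIntegral.integral_const,
    smul_eq_mul]
  ring

/-- integral identities for the explicit solution `(v*, w*)`:
for `t ∈ [0, x_*²/(4B²) − t_*]` one has `∫v* = √32·B·x_*`,
`∫½(v*)² = 8B²x_* − (16/3)B³√(t+t_*)`, `∫w* = (16/3)B³√(t+t_*)`, and the total energy
`∫(½(v*)² + w*) = 8B²x_*`; in particular momentum and energy are constant in time. -/
theorem explicit_solution_integral_identities
    (B xstar tstar : ℝ) (hB : 0 < B) (hx : 0 < xstar) (ht : 0 < tstar)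
    (htT : tstar < xstar ^ 2 / (4 * B ^ 2)) :
    ∀ t ∈ Set.Icc (0 : ℝ) (xstar ^ 2 / (4 * B ^ 2) - tstar),
      (∫ x : ℝ, vstar B xstar tstar t x) = Real.sqrt 32 * B * xstar ∧
      (∫ x : ℝ, (vstar B xstar tstar t x) ^ 2 / 2)
        = 8 * B ^ 2 * xstar - (16 / 3) * B ^ 3 * Real.sqrt (t + tstar) ∧
      (∫ x : ℝ, wstar B xstar tstar t x) = (16 / 3) * B ^ 3 * Real.sqrt (t + tstar) ∧
      (∫ x : ℝ, ((vstar B xstar tstar t x) ^ 2 / 2 + wstar B xstar tstar t x))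
        = 8 * B ^ 2 * xstar := by
  rintro t ⟨ht0, htT'⟩
  have hpos : 0 < t + tstar := by linarith
  set s := Real.sqrt (t + tstar) with hs
  have hs0 : 0 < s := Real.sqrt_pos.2 hpos
  have hs2 : s ^ 2 = t + tstar := Real.sq_sqrt hpos.le
  have hr : 0 ≤ 2 * B * s := by positivity
  have hm : 2 * B * s ≤ xstar := by
    have h : t + tstar ≤ xstar ^ 2 / (4 * B ^ 2) := by linarith
    rw [le_div_iff₀ (by positivity), ← hs2] at h
    exact le_of_sq_le_sq (by linarith) hx.le
  have h2 : Real.sqrt 2 ^ 2 = 2 := Real.sq_sqrt (by norm_num)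
  have h32 : Real.sqrt 32 = 4 * Real.sqrt 2 := by
    rw [Real.sqrt_eq_iff_mul_self_eq (by norm_num) (by positivity)]
    linarith
  have outside : ∀ x, x < -xstar - 2 * B * s ∨ xstar + 2 * B * s < x →
      vstar B xstar tstar t x = 0 ∧ wstar B xstar tstar t x = 0 := by
    intro x h
    have n₁ : ¬ |x + xstar| ≤ 2 * B * s := fun h' => by
      rcases h with h | h <;> linarith [(abs_le.1 h').1, (abs_le.1 h').2]
    have n₂ : ¬ |x| ≤ xstar - 2 * B * s := fun h' => by
      rcases h with h | h <;> linarith [(abs_le.1 h').1, (abs_le.1 h').2]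
    have n₃ : ¬ |x - xstar| ≤ 2 * B * s := fun h' => by
      rcases h with h | h <;> linarith [(abs_le.1 h').1, (abs_le.1 h').2]
    simp only [vstar, wstar, ← hs, if_neg n₁, if_neg n₂, if_neg n₃, and_self]
  have left : ∀ x, -xstar - 2 * B * s < x → x ≤ -xstar + 2 * B * s →
      vstar B xstar tstar t x = Real.sqrt 2 * B + 1 / (Real.sqrt 2 * s) * (x + xstar) ∧
      wstar B xstar tstar t x = B ^ 2 - (x + xstar) ^ 2 / (4 * s ^ 2) := by
    intro x h h'
    have n₁ : |x + xstar| ≤ 2 * B * s := abs_le.2 ⟨by linarith, by linarith⟩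
    simp only [vstar, wstar, ← hs, if_pos n₁, hs2, and_true]
    field_simp
    linear_combination (-B * s) * h2
  have right : ∀ x, -xstar + 2 * B * s < x → xstar - 2 * B * s < x → x ≤ xstar + 2 * B * s →
      vstar B xstar tstar t x = Real.sqrt 2 * B + -(1 / (Real.sqrt 2 * s)) * (x - xstar) ∧
      wstar B xstar tstar t x = B ^ 2 - (x - xstar) ^ 2 / (4 * s ^ 2) := by
    intro x hb h h'
    have n₁ : ¬ |x + xstar| ≤ 2 * B * s := fun h' => by linarith [(abs_le.1 h').2]
    have n₂ : ¬ |x| ≤ xstar - 2 * B * s := fun h' => by linarith [(abs_le.1 h').2]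
    have n₃ : |x - xstar| ≤ 2 * B * s := abs_le.2 ⟨by linarith, by linarith⟩
    simp only [vstar, wstar, ← hs, if_neg n₁, if_neg n₂, if_pos n₃, hs2, and_true]
    field_simp
    linear_combination (-B * s) * h2
  have middle_v : ∀ x, -xstar + 2 * B * s < x → x ≤ xstar - 2 * B * s →
      vstar B xstar tstar t x = 2 * Real.sqrt 2 * B := by
    intro x h h'
    have n₁ : ¬ |x + xstar| ≤ 2 * B * s := fun h' => by linarith [(abs_le.1 h').2]
    have n₂ : |x| ≤ xstar - 2 * B * s := abs_le.2 ⟨by linarith, by linarith⟩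
    simp only [vstar, ← hs, if_neg n₁, if_pos n₂]
  have middle_w : ∀ x, -xstar + 2 * B * s < x → x ≤ xstar - 2 * B * s →
      wstar B xstar tstar t x = 0 := by
    intro x h h'
    have n₁ : ¬ |x + xstar| ≤ 2 * B * s := fun h' => by linarith [(abs_le.1 h').2]
    simp only [wstar, ← hs, if_neg n₁]
    split_ifs with n₃
    · have : x - xstar = -(2 * B * s) := by linarith [(abs_le.1 n₃).1]
      rw [this, ← hs2]
      field_simp
      ring
    · rfl
  have square_eq : ∀ y ε : ℝ, ε ^ 2 = 1 →
      (Real.sqrt 2 * B + ε * (1 / (Real.sqrt 2 * s)) * y) ^ 2 / 2 =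
        B ^ 2 + ε * (B / s) * y + 1 / (4 * s ^ 2) * y ^ 2 := by
    intro y ε hε
    have e : (Real.sqrt 2 * B + ε * (1 / (Real.sqrt 2 * s)) * y) ^ 2 =
        Real.sqrt 2 ^ 2 * B ^ 2 + 2 * ε * B / s * y + ε ^ 2 / (Real.sqrt 2 ^ 2 * s ^ 2) * y ^ 2 := by
      field_simp
      ring
    rw [e, h2, hε]
    field_simp
    ring
  have V := integrable_and_integral_of_piecewise_quadratic (f := vstar B xstar tstar t)
    (α := Real.sqrt 2 * B) (β := 1 / (Real.sqrt 2 * s)) (γ := 0)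
    (α' := Real.sqrt 2 * B) (β' := -(1 / (Real.sqrt 2 * s))) (γ' := 0) hr hm
    (fun x h => (outside x (.inl h)).1)
    (fun x h h' => by rw [(left x h h').1, zero_mul, add_zero])
    middle_v
    (fun x h h' h'' => by rw [(right x h h' h'').1, zero_mul, add_zero])
    (fun x h => (outside x (.inr h)).1)
  have E := integrable_and_integral_of_piecewise_quadratic
    (f := fun x => vstar B xstar tstar t x ^ 2 / 2)
    (α := B ^ 2) (β := B / s) (γ := 1 / (4 * s ^ 2)) (κ := 4 * B ^ 2)
    (α' := B ^ 2) (β' := -1 * (B / s)) (γ' := 1 / (4 * s ^ 2)) hr hm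
    (fun x h => by simp [(outside x (.inl h)).1])
    (fun x h h' => by
      have := square_eq (x + xstar) 1 (by norm_num)
      rw [one_mul, one_mul] at this
      rw [(left x h h').1, this])
    (fun x h h' => by
      simp only [middle_v x h h', mul_pow, h2]
      ring)
    (fun x h h' h'' => by
      have := square_eq (x - xstar) (-1) (by norm_num)
      rw [(right x h h' h'').1, ← this, neg_one_mul])
    (fun x h => by simp [(outside x (.inr h)).1])
  have W := integrable_and_integral_of_piecewise_quadratic (f := wstar B xstar tstar t)
    (α := B ^ 2) (β := 0) (γ := -(1 / (4 * s ^ 2))) (κ := 0)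
    (α' := B ^ 2) (β' := 0) (γ' := -(1 / (4 * s ^ 2))) hr hm
    (fun x h => (outside x (.inl h)).2)
    (fun x h h' => by rw [(left x h h').2]; ring)
    middle_w
    (fun x h h' h'' => by rw [(right x h h' h'').2]; ring)
    (fun x h => (outside x (.inr h)).2)
  have hE : ∫ x, vstar B xstar tstar t x ^ 2 / 2 =
      8 * B ^ 2 * xstar - (16 / 3) * B ^ 3 * s := by
    rw [E.2]
    field_simp
    ring
  have hW : ∫ x, wstar B xstar tstar t x = (16 / 3) * B ^ 3 * s := by
    rw [W.2]
    field_simp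
    ring
  refine ⟨?_, hE, hW, ?_⟩
  · rw [V.2, h32]
    ring
  · rw [integral_add E.1 W.1, hE, hW]
    ring
end

section
/- Steady states in momentum-conserving similarity variables (Proposition 7.3, verification): let d ≥ 1, β > 0, η₀, κ₀ > 0, a ∈ ℝ, c > 0, set δ = 1/(2+dβ), σ = κ₀/(η₀β), and b > 0 with b² = βδ/(2 c^β κ₀). Define v̂(y) = a (1 − |by|²)^σ and w̃(y) = c (1 − |by|²)^{1/β} for |by| < 1. Then for every y with |by| < 1 the fluxes vanish identically: δ v̂(y) y + η₀ w̃(y)^β ∇v̂(y) = 0 and δ w̃(y) y + κ₀ w̃(y)^β ∇w̃(y) = 0; in particular (v̂, w̃), extended by zero for |by| ≥ 1, satisfies 0 = div(δ v̂ y + η₀ w̃^β ∇v̂) and 0 = div(δ w̃ y + κ₀ w̃^β ∇w̃) pointwise on {y : |by| < 1}. -/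
open MeasureTheory

/-- The derivative of the profile `A(1−|bz|²)^p` in the `i`-th coordinate direction, inside the
ball `|bz| < 1`. -/
theorem fderiv_profile_single {d : ℕ} (A b p : ℝ) (z : EuclideanSpace ℝ (Fin d))
    (hz : 0 < 1 - ‖b • z‖ ^ 2) (i : Fin d) :
    fderiv ℝ (fun y : EuclideanSpace ℝ (Fin d) => A * (1 - ‖b • y‖ ^ 2) ^ p) z
        (EuclideanSpace.single i 1)
      = -(2 * A * p * b ^ 2 * (1 - ‖b • z‖ ^ 2) ^ (p - 1) * z i) := by
  have hbase : HasFDerivAt (fun y : EuclideanSpace ℝ (Fin d) => 1 - ‖b • y‖ ^ 2) _ z :=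
    (((hasFDerivAt_id z).const_smul b).norm_sq).const_sub 1
  have hprof := (hbase.rpow_const (p := p) (Or.inl hz.ne')).const_mul A
  rw [hprof.fderiv]
  simp [EuclideanSpace.inner_single_right]
  ring

/-- The flux `δ A u^p z + k w^β ∇(A u^p)` with `u = 1−|bz|²` and `w = c u^{1/β}` vanishes inside the
ball `|bz| < 1` as soon as `2 k p b² c^β = δ`. -/
theorem profile_flux_eq_zero {d : ℕ} {A b p k c β δ : ℝ} (hβ : β ≠ 0) (hc : 0 ≤ c)
    (hk : 2 * k * p * b ^ 2 * c ^ β = δ) (z : EuclideanSpace ℝ (Fin d))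
    (hz : 0 < 1 - ‖b • z‖ ^ 2) (i : Fin d) :
    δ * (A * (1 - ‖b • z‖ ^ 2) ^ p) * z i
      + k * (c * (1 - ‖b • z‖ ^ 2) ^ (1 / β)) ^ β
        * fderiv ℝ (fun y : EuclideanSpace ℝ (Fin d) => A * (1 - ‖b • y‖ ^ 2) ^ p) z
            (EuclideanSpace.single i 1) = 0 := by
  rw [fderiv_profile_single A b p z hz i, Real.mul_rpow hc (Real.rpow_nonneg hz.le _),
    ← Real.rpow_mul hz.le, one_div_mul_cancel hβ, Real.rpow_one, Real.rpow_sub_one hz.ne', ← hk]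
  field_simp
  ring

/-- Proposition 7.3, verification: with `δ = 1/(2+dβ)`, `σ = κ₀/(η₀β)` and
`b² = βδ/(2c^βκ₀)`, the profiles `v̂(y) = a(1−|by|²)^σ`, `w̃(y) = c(1−|by|²)^{1/β}` have
pointwise vanishing fluxes `δv̂y + η₀w̃^β∇v̂ = 0` and `δw̃y + κ₀w̃^β∇w̃ = 0` on `{|by| < 1}`;
in particular both divergences `div(δv̂y + η₀w̃^β∇v̂)` and `div(δw̃y + κ₀w̃^β∇w̃)` vanish there. -/
theorem steady_similarity_profile_fluxes_vanish
    (d : ℕ) (hd : 1 ≤ d) (β η₀ κ₀ a c : ℝ)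
    (hβ : 0 < β) (hη₀ : 0 < η₀) (hκ₀ : 0 < κ₀) (hc : 0 < c)
    (δ σ b : ℝ) (hδ : δ = 1 / (2 + d * β)) (hσ : σ = κ₀ / (η₀ * β))
    (hb : 0 < b) (hb2 : b ^ 2 = β * δ / (2 * c ^ β * κ₀)) :
    let vhat : EuclideanSpace ℝ (Fin d) → ℝ := fun y => a * (1 - ‖b • y‖ ^ 2) ^ σ
    let wtil : EuclideanSpace ℝ (Fin d) → ℝ := fun y => c * (1 - ‖b • y‖ ^ 2) ^ (1 / β)
    ∀ y : EuclideanSpace ℝ (Fin d), b * ‖y‖ < 1 →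
      (∀ i : Fin d,
        δ * vhat y * y i
          + η₀ * (wtil y) ^ β * fderiv ℝ vhat y (EuclideanSpace.single i 1) = 0) ∧
      (∀ i : Fin d,
        δ * wtil y * y i
          + κ₀ * (wtil y) ^ β * fderiv ℝ wtil y (EuclideanSpace.single i 1) = 0) ∧
      (∑ i, fderiv ℝ
          (fun z => δ * vhat z * z i
            + η₀ * (wtil z) ^ β * fderiv ℝ vhat z (EuclideanSpace.single i 1))
          y (EuclideanSpace.single i 1) = 0) ∧
      (∑ i, fderiv ℝ
          (fun z => δ * wtil z * z i
            + κ₀ * (wtil z) ^ β * fderiv ℝ wtil z (EuclideanSpace.single i 1))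
          y (EuclideanSpace.single i 1) = 0) := by
  intro vhat wtil y hy
  have hball : ∀ z : EuclideanSpace ℝ (Fin d), b * ‖z‖ < 1 → 0 < 1 - ‖b • z‖ ^ 2 := by
    intro z hz
    have hnonneg : 0 ≤ b * ‖z‖ := by positivity
    rw [norm_smul, Real.norm_of_nonneg hb.le]
    nlinarith
  have hcβ : 0 < c ^ β := Real.rpow_pos_of_pos hc β
  have hv : ∀ z : EuclideanSpace ℝ (Fin d), b * ‖z‖ < 1 → ∀ i : Fin d,
      δ * vhat z * z i
        + η₀ * (wtil z) ^ β * fderiv ℝ vhat z (EuclideanSpace.single i 1) = 0 :=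
    fun z hz i => profile_flux_eq_zero hβ.ne' hc.le
      (by rw [hb2, hσ]; field_simp) z (hball z hz) i
  have hw : ∀ z : EuclideanSpace ℝ (Fin d), b * ‖z‖ < 1 → ∀ i : Fin d,
      δ * wtil z * z i
        + κ₀ * (wtil z) ^ β * fderiv ℝ wtil z (EuclideanSpace.single i 1) = 0 :=
    fun z hz i => profile_flux_eq_zero hβ.ne' hc.le
      (by rw [hb2]; field_simp) z (hball z hz) i
  have hnear : ∀ᶠ z : EuclideanSpace ℝ (Fin d) in nhds y, b * ‖z‖ < 1 :=
    (continuous_const.mul continuous_norm).continuousAt.eventually_lt_const hy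
  have hdiv : ∀ F : Fin d → EuclideanSpace ℝ (Fin d) → ℝ,
      (∀ z, b * ‖z‖ < 1 → ∀ i, F i z = 0) →
      ∑ i, fderiv ℝ (F i) y (EuclideanSpace.single i 1) = 0 := by
    intro F hF
    refine Finset.sum_eq_zero fun i _ => ?_
    have hFi : F i =ᶠ[nhds y] fun _ => (0 : ℝ) := hnear.mono fun z hz => hF z hz i
    rw [hFi.fderiv_eq]
    simp
  exact ⟨hv y hy, hw y hy, hdiv _ hv, hdiv _ hw⟩
end
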